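/- arXiv:2304.14202 — 2 statements merged into one kernel-verified Lean document; each statement's English description precedes it below -/
import Mathlib

section
/- For every s ≥ 0, the limit F(s) := lim_{N→∞} F_N(s) exists and is given as follows: if k ∈ ℕ₀ is the unique integer with k/(2 log 2) ≤ s < (k+1)/(2 log 2), then F(s) = 3k − (3k² + 2k)/(4·log(2)·s) when k is even (with F(0) = 0), and F(s) = 3k + 1 − (3k² + 4k + 1)/(4·log(2)·s) when k is odd. -/
open scoped Classical

/-- The sequence `x_n = {log(2n-1)/log 2}`. -/
noncomputable def xseq (n : ℕ) : ℝ := Int.fract (Real.log (2 * (n : ℝ) - 1) / Real.log 2)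

/-- Distance of a real number to the nearest integer. -/
noncomputable def torusNorm (t : ℝ) : ℝ := |t - round t|

/-- The pair correlation function `F_N(s)`. -/
noncomputable def pcf (N : ℕ) (s : ℝ) : ℝ :=
  (((Finset.Icc 1 N ×ˢ Finset.Icc 1 N).filter
      (fun p => p.1 ≠ p.2 ∧ torusNorm (xseq p.1 - xseq p.2) ≤ s / N)).card : ℝ) / N

open Filter Topology

/-! ### The distance to the nearest integer -/

lemma torusNorm_add_intCast (x : ℝ) (n : ℤ) : torusNorm (x + n) = torusNorm x := by
  unfold torusNorm
  rw [round_add_intCast]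
  push_cast
  congr 1
  ring

lemma torusNorm_neg (x : ℝ) : torusNorm (-x) = torusNorm x := by
  have key : ∀ y : ℝ, torusNorm (-y) ≤ torusNorm y := fun y => by
    unfold torusNorm
    refine (round_le (-y) (-round y)).trans_eq ?_
    rw [← abs_neg]
    push_cast
    congr 1
    ring
  exact le_antisymm (key x) (by simpa using key (-x))

lemma torusNorm_le_iff {x r : ℝ} (h0 : 0 ≤ x) (h1 : x < 1) :
    torusNorm x ≤ r ↔ x ≤ r ∨ 1 - x ≤ r := by
  unfold torusNorm
  rw [abs_sub_round_eq_min, Int.fract_eq_self.2 ⟨h0, h1⟩, min_le_iff]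

/-! ### Reindexing by the integers in `[N, 2N)` -/

/-- The index `n` for which `2 * n - 1` is the odd part of `a`. -/
def oddIndex (a : ℕ) : ℕ := (ordCompl[2] a + 1) / 2

lemma two_mul_oddIndex {a : ℕ} (ha : a ≠ 0) : 2 * oddIndex a = ordCompl[2] a + 1 := by
  have h := Nat.not_dvd_ordCompl Nat.prime_two ha
  unfold oddIndex
  omega

lemma two_pow_mul_oddIndex {a : ℕ} (ha : a ≠ 0) :
    2 ^ a.factorization 2 * (2 * oddIndex a - 1) = a := by
  rw [two_mul_oddIndex ha, Nat.add_sub_cancel, Nat.ordProj_mul_ordCompl_eq_self]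

lemma oddIndex_mem {N a : ℕ} (ha : a ∈ Finset.Ico N (2 * N)) :
    oddIndex a ∈ Finset.Icc 1 N := by
  rw [Finset.mem_Ico] at ha
  have h0 : a ≠ 0 := by omega
  have h := two_mul_oddIndex h0
  have hle := Nat.ordCompl_le a 2
  have hpos := Nat.ordCompl_pos 2 h0
  rw [Finset.mem_Icc]
  omega

lemma oddIndex_injOn (N : ℕ) : Set.InjOn oddIndex (Finset.Ico N (2 * N) : Finset ℕ) := by
  have key : ∀ a ∈ Finset.Ico N (2 * N), ∀ b ∈ Finset.Ico N (2 * N),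
      oddIndex a = oddIndex b → b.factorization 2 ≤ a.factorization 2 := by
    intro a ha b hb hab
    rw [Finset.mem_Ico] at ha hb
    have h1 := two_pow_mul_oddIndex (a := a) (by omega)
    have h2 := two_pow_mul_oddIndex (a := b) (by omega)
    rw [← hab] at h2
    by_contra! hlt
    have h3 : 2 ^ (a.factorization 2 + 1) ≤ 2 ^ b.factorization 2 :=
      Nat.pow_le_pow_right (by norm_num) hlt
    have h4 := Nat.mul_le_mul_right (2 * oddIndex a - 1) h3
    rw [h2, pow_succ, mul_right_comm, h1] at h4
    omega
  intro a ha b hb hab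
  have he := le_antisymm (key b hb a ha hab.symm) (key a ha b hb hab)
  simp only [Finset.coe_Ico, Set.mem_Ico] at ha hb
  rw [← two_pow_mul_oddIndex (a := a) (by omega), ← two_pow_mul_oddIndex (a := b) (by omega),
    he, hab]

lemma image_oddIndex (N : ℕ) :
    (Finset.Ico N (2 * N)).image oddIndex = Finset.Icc 1 N := by
  apply Finset.eq_of_subset_of_card_le
  · intro n hn
    obtain ⟨a, ha, rfl⟩ := Finset.mem_image.1 hn
    exact oddIndex_mem ha
  · rw [Finset.card_image_of_injOn (oddIndex_injOn N)]
    simp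
    omega

lemma exists_xseq_oddIndex {a : ℕ} (ha : a ≠ 0) :
    ∃ z : ℤ, xseq (oddIndex a) = Real.logb 2 a + z := by
  have h := two_pow_mul_oddIndex ha
  have h1 : 1 ≤ 2 * oddIndex a := by rw [two_mul_oddIndex ha]; exact Nat.le_add_left _ _
  have hR : (a : ℝ) = 2 ^ a.factorization 2 * (2 * (oddIndex a : ℝ) - 1) := by
    conv_lhs => rw [← h]
    push_cast [Nat.cast_sub h1]
    ring
  have hpos : (2 * (oddIndex a : ℝ) - 1) ≠ 0 := by
    intro h0
    rw [h0, mul_zero] at hR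
    exact ha (by exact_mod_cast hR)
  refine ⟨-(a.factorization 2 : ℤ) - ⌊Real.log (2 * (oddIndex a : ℝ) - 1) / Real.log 2⌋, ?_⟩
  have hl : Real.logb 2 a = a.factorization 2 + Real.logb 2 (2 * (oddIndex a : ℝ) - 1) := by
    rw [hR, Real.logb_mul (by positivity) hpos, Real.logb_pow]
    simp
  rw [hl]
  unfold xseq Real.logb
  rw [← Int.self_sub_floor]
  push_cast
  ring

lemma torusNorm_xseq_oddIndex {a b : ℕ} (ha : a ≠ 0) (hb : b ≠ 0) :
    torusNorm (xseq (oddIndex a) - xseq (oddIndex b)) =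
      torusNorm (Real.logb 2 a - Real.logb 2 b) := by
  obtain ⟨y, hy⟩ := exists_xseq_oddIndex ha
  obtain ⟨z, hz⟩ := exists_xseq_oddIndex hb
  rw [hy, hz, ← torusNorm_add_intCast (Real.logb 2 a - Real.logb 2 b) (y - z)]
  push_cast
  congr 1
  ring

lemma torusNorm_logb_le_iff {N a b : ℕ} {r : ℝ} (ha : N ≤ a) (hab : a < b) (hb : b < 2 * N) :
    torusNorm (Real.logb 2 a - Real.logb 2 b) ≤ r ↔
      (b : ℝ) ≤ a * 2 ^ r ∨ 2 * (a : ℝ) ≤ b * 2 ^ r := by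
  have ha0 : (0 : ℝ) < a := by exact_mod_cast (by omega : 0 < a)
  have hb0 : (0 : ℝ) < b := by exact_mod_cast (by omega : 0 < b)
  have hab' : (a : ℝ) < b := by exact_mod_cast hab
  have hb2 : (b : ℝ) < 2 * a := by exact_mod_cast (by omega : b < 2 * a)
  have h2a : Real.logb 2 (2 * a) = 1 + Real.logb 2 a := by
    rw [Real.logb_mul (by norm_num) ha0.ne', Real.logb_self_eq_one (by norm_num)]
  have hlt := Real.logb_lt_logb (b := 2) (by norm_num) ha0 hab'
  have hlt2 := Real.logb_lt_logb (b := 2) (by norm_num) hb0 hb2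
  have hmul : ∀ c : ℝ, 0 < c → Real.logb 2 (c * 2 ^ r) = Real.logb 2 c + r := fun c hc => by
    rw [Real.logb_mul hc.ne' (by positivity), Real.logb_rpow (by norm_num) (by norm_num)]
  rw [← torusNorm_neg, torusNorm_le_iff (by linarith) (by linarith),
    ← Real.logb_le_logb (b := 2) (by norm_num) hb0 (by positivity),
    ← Real.logb_le_logb (b := 2) (by norm_num) (by positivity) (by positivity : 0 < (b : ℝ) * 2 ^ r),
    hmul a ha0, hmul b hb0, h2a]
  constructor <;> rintro (h | h) <;> [left; right; left; right] <;> linarith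

/-- Pairs `a < b` in `[N, 2N)` whose quotient `b / a` is at most `q`. -/
noncomputable def closePairs (N : ℕ) (q : ℝ) : Finset (ℕ × ℕ) :=
  (Finset.Ico N (2 * N) ×ˢ Finset.Ico N (2 * N)).filter
    fun p => p.1 < p.2 ∧ (p.2 : ℝ) ≤ p.1 * q

/-- Pairs `a < b` in `[N, 2N)` whose quotient `2 * a / b` is at most `q`. -/
noncomputable def wrapPairs (N : ℕ) (q : ℝ) : Finset (ℕ × ℕ) :=
  (Finset.Ico N (2 * N) ×ˢ Finset.Ico N (2 * N)).filter
    fun p => p.1 < p.2 ∧ 2 * (p.1 : ℝ) ≤ p.2 * q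

lemma pcf_eq (N : ℕ) (s : ℝ) :
    pcf N s = 2 * ((closePairs N (2 ^ (s / N)) ∪ wrapPairs N (2 ^ (s / N))).card : ℝ) / N := by
  set T := closePairs N (2 ^ (s / N)) ∪ wrapPairs N (2 ^ (s / N)) with hT
  have hmem : ∀ a b : ℕ, (a, b) ∈ T ↔ a ∈ Finset.Ico N (2 * N) ∧ b ∈ Finset.Ico N (2 * N) ∧
      a < b ∧ torusNorm (Real.logb 2 a - Real.logb 2 b) ≤ s / N := by
    intro a b
    have := @torusNorm_logb_le_iff N a b (s / N)
    simp only [hT, closePairs, wrapPairs, Finset.mem_union, Finset.mem_filter,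
      Finset.mem_product, Finset.mem_Ico]
    constructor
    · rintro (h | h)
      · exact ⟨h.1.1, h.1.2, h.2.1, (this h.1.1.1 h.2.1 h.1.2.2).2 (Or.inl h.2.2)⟩
      · exact ⟨h.1.1, h.1.2, h.2.1, (this h.1.1.1 h.2.1 h.1.2.2).2 (Or.inr h.2.2)⟩
    · rintro ⟨h1, h2, h3, h4⟩
      rcases (this h1.1 h3 h2.2).1 h4 with h | h
      · exact Or.inl ⟨⟨h1, h2⟩, h3, h⟩
      · exact Or.inr ⟨⟨h1, h2⟩, h3, h⟩
  have hdisj : Disjoint T (T.image Prod.swap) := by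
    rw [Finset.disjoint_left]
    rintro ⟨a, b⟩ h h'
    obtain ⟨⟨c, d⟩, hcd, heq⟩ := Finset.mem_image.1 h'
    simp only [Prod.swap_prod_mk, Prod.mk.injEq] at heq
    obtain ⟨rfl, rfl⟩ := heq
    have h1 := ((hmem _ _).1 h).2.2.1
    have h2 := ((hmem _ _).1 hcd).2.2.1
    omega
  have hcard : ((Finset.Icc 1 N ×ˢ Finset.Icc 1 N).filter
      (fun p => p.1 ≠ p.2 ∧ torusNorm (xseq p.1 - xseq p.2) ≤ s / N)) =
      (T ∪ T.image Prod.swap).image (Prod.map oddIndex oddIndex) := by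
    ext ⟨m, n⟩
    simp only [Finset.mem_filter, Finset.mem_product, ← image_oddIndex N]
    constructor
    · rintro ⟨⟨hm, hn⟩, hne, hle⟩
      obtain ⟨a, ha, rfl⟩ := Finset.mem_image.1 hm
      obtain ⟨b, hb, rfl⟩ := Finset.mem_image.1 hn
      have ha' := Finset.mem_Ico.1 ha
      have hb' := Finset.mem_Ico.1 hb
      rw [torusNorm_xseq_oddIndex (by omega) (by omega)] at hle
      refine Finset.mem_image.2 ⟨(a, b), ?_, rfl⟩
      rcases lt_trichotomy a b with h | rfl | h
      · exact Finset.mem_union_left _ ((hmem a b).2 ⟨ha, hb, h, hle⟩)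
      · exact absurd rfl hne
      · refine Finset.mem_union_right _ (Finset.mem_image.2 ⟨(b, a), ?_, rfl⟩)
        rw [← torusNorm_neg, neg_sub] at hle
        exact (hmem b a).2 ⟨hb, ha, h, hle⟩
    · intro h
      obtain ⟨⟨a, b⟩, hab, heq⟩ := Finset.mem_image.1 h
      simp only [Prod.map_apply, Prod.mk.injEq] at heq
      obtain ⟨rfl, rfl⟩ := heq
      have h3 : a ∈ Finset.Ico N (2 * N) ∧ b ∈ Finset.Ico N (2 * N) ∧ a ≠ b ∧
          torusNorm (Real.logb 2 a - Real.logb 2 b) ≤ s / N := by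
        rcases Finset.mem_union.1 hab with h | h
        · obtain ⟨h1, h2, h3, h4⟩ := (hmem a b).1 h
          exact ⟨h1, h2, h3.ne, h4⟩
        · obtain ⟨⟨c, d⟩, hcd, heq⟩ := Finset.mem_image.1 h
          simp only [Prod.swap_prod_mk, Prod.mk.injEq] at heq
          obtain ⟨rfl, rfl⟩ := heq
          obtain ⟨h1, h2, h3, h4⟩ := (hmem _ _).1 hcd
          rw [← torusNorm_neg, neg_sub] at h4
          exact ⟨h2, h1, h3.ne', h4⟩
      obtain ⟨ha, hb, hne, hle⟩ := h3
      have ha' := Finset.mem_Ico.1 ha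
      have hb' := Finset.mem_Ico.1 hb
      refine ⟨⟨Finset.mem_image_of_mem _ ha, Finset.mem_image_of_mem _ hb⟩, ?_, ?_⟩
      · exact fun h => hne (oddIndex_injOn N ha hb h)
      · rwa [torusNorm_xseq_oddIndex (by omega) (by omega)]
  have hinj : Set.InjOn (Prod.map oddIndex oddIndex)
      (T ∪ T.image Prod.swap : Finset (ℕ × ℕ)) := by
    have hsub : ∀ p ∈ T ∪ T.image Prod.swap,
        p.1 ∈ Finset.Ico N (2 * N) ∧ p.2 ∈ Finset.Ico N (2 * N) := by
      intro p hp
      rcases Finset.mem_union.1 hp with h | h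
      · exact ⟨((hmem _ _).1 h).1, ((hmem _ _).1 h).2.1⟩
      · obtain ⟨q, hq, rfl⟩ := Finset.mem_image.1 h
        exact ⟨((hmem _ _).1 hq).2.1, ((hmem _ _).1 hq).1⟩
    intro p hp q hq hpq
    simp only [Prod.map, Prod.mk.injEq] at hpq
    exact Prod.ext (oddIndex_injOn N (hsub p hp).1 (hsub q hq).1 hpq.1)
      (oddIndex_injOn N (hsub p hp).2 (hsub q hq).2 hpq.2)
  unfold pcf
  rw [hcard, Finset.card_image_of_injOn hinj, Finset.card_union_of_disjoint hdisj,
    Finset.card_image_of_injective _ Prod.swap_injective]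
  push_cast
  ring

/-! ### Counting the pairs -/

lemma card_wrapPairs_le {N k : ℕ} {q : ℝ} (hq1 : 1 ≤ q) (hq : 2 * N * (q - 1) < k + 1) :
    (wrapPairs N q).card ≤ (k + 1) * (k + 1) := by
  have hsub : wrapPairs N q ⊆
      Finset.Ico N (N + (k + 1)) ×ˢ Finset.Ico (2 * N - (k + 1)) (2 * N) := by
    rintro ⟨a, b⟩ h
    simp only [wrapPairs, Finset.mem_filter, Finset.mem_product, Finset.mem_Ico] at h ⊢
    obtain ⟨⟨⟨h1, h2⟩, h3, h4⟩, h5, h6⟩ := h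
    have hb : (b : ℝ) ≤ 2 * N := by exact_mod_cast h4.le
    have h7 : (b : ℝ) * (q - 1) ≤ 2 * N * (q - 1) :=
      mul_le_mul_of_nonneg_right hb (by linarith)
    have h8 : (2 * a : ℝ) < b + (k + 1) := by linarith
    have h9 : 2 * a < b + (k + 1) := by exact_mod_cast h8
    omega
  refine (Finset.card_le_card hsub).trans ?_
  rw [Finset.card_product, Nat.card_Ico, Nat.card_Ico]
  exact Nat.mul_le_mul (by omega) (by omega)

lemma card_closePairs {N k : ℕ} {q : ℝ} (hq1 : 1 < q) (hq : 2 * N * (q - 1) < k + 1) :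
    (closePairs N q).card =
      ∑ j ∈ Finset.Icc 1 k, (2 * N - j - max N ⌈(j : ℝ) / (q - 1)⌉₊) := by
  have hq0 : 0 < q - 1 := by linarith
  have hmaps : ∀ p ∈ closePairs N q, p.2 - p.1 ∈ Finset.Icc 1 k := by
    rintro ⟨a, b⟩ h
    simp only [closePairs, Finset.mem_filter, Finset.mem_product, Finset.mem_Ico,
      Finset.mem_Icc] at h ⊢
    obtain ⟨⟨⟨h1, h2⟩, h3, h4⟩, h5, h6⟩ := h
    have ha : (a : ℝ) ≤ 2 * N := by exact_mod_cast h2.le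
    have h7 : (a : ℝ) * (q - 1) ≤ 2 * N * (q - 1) := mul_le_mul_of_nonneg_right ha hq0.le
    have h8 : (b : ℝ) < a + (k + 1) := by linarith
    have h9 : b < a + (k + 1) := by exact_mod_cast h8
    omega
  rw [Finset.card_eq_sum_card_fiberwise hmaps]
  refine Finset.sum_congr rfl fun j hj => ?_
  rw [Finset.mem_Icc] at hj
  rw [Nat.sub_sub, Nat.add_comm j, ← Nat.sub_sub, Nat.sub_right_comm, ← Nat.card_Ico,
    ← Finset.card_image_of_injective (Finset.Ico _ _) (f := fun a : ℕ => (a, a + j))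
      (fun a b h => (Prod.mk.inj h).1)]
  congr 1
  ext ⟨a, b⟩
  simp only [closePairs, Finset.mem_filter, Finset.mem_product, Finset.mem_Ico,
    Finset.mem_image, Prod.mk.injEq, max_le_iff, Nat.ceil_le, div_le_iff₀ hq0]
  constructor
  · rintro ⟨⟨⟨⟨h1, h2⟩, h3, h4⟩, h5, h6⟩, h7⟩
    obtain rfl : b = a + j := by omega
    refine ⟨a, ⟨⟨h1, ?_⟩, by omega⟩, rfl, rfl⟩
    push_cast at h6
    linarith
  · rintro ⟨c, ⟨⟨h1, h2⟩, h3⟩, rfl, rfl⟩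
    refine ⟨⟨⟨⟨h1, by omega⟩, by omega, by omega⟩, by omega, ?_⟩, by omega⟩
    push_cast
    linarith

/-! ### The limit -/

lemma tendsto_mul_two_rpow_sub_one (s : ℝ) :
    Tendsto (fun N : ℕ => (N : ℝ) * ((2 : ℝ) ^ (s / N) - 1)) atTop (𝓝 (s * Real.log 2)) := by
  have hd : HasDerivAt (fun x : ℝ => (2 : ℝ) ^ (s * x)) (s * Real.log 2) 0 := by
    have := ((hasDerivAt_id (0 : ℝ)).const_mul s).const_rpow (a := 2) (by norm_num)
    simpa [mul_comm] using this
  have h := hd.tendsto_slope_zero_right.comp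
    (tendsto_inv_atTop_nhdsGT_zero.comp (tendsto_natCast_atTop_atTop (R := ℝ)))
  refine h.congr fun N => ?_
  simp [div_eq_mul_inv]

lemma tendsto_sub_max_ceil_div {ε : ℕ → ℝ} {u : ℝ} (hu : 0 < u)
    (hε : Tendsto (fun N : ℕ => (N : ℝ) * ε N) atTop (𝓝 u)) (j : ℕ) :
    Tendsto (fun N : ℕ => ((2 * N - j - max N ⌈(j : ℝ) / ε N⌉₊ : ℕ) : ℝ) / N) atTop
      (𝓝 (max (2 - max 1 (j / u)) 0)) := by
  have hinv : Tendsto (fun N : ℕ => (1 : ℝ) / N) atTop (𝓝 0) :=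
    tendsto_one_div_atTop_nhds_zero_nat
  have hlow : Tendsto (fun N : ℕ => (j : ℝ) / (N * ε N)) atTop (𝓝 (j / u)) :=
    tendsto_const_nhds.div hε hu.ne'
  have hceil : Tendsto (fun N : ℕ => (⌈(j : ℝ) / ε N⌉₊ : ℝ) / N) atTop (𝓝 (j / u)) := by
    refine tendsto_of_tendsto_of_tendsto_of_le_of_le' hlow
      (h := fun N : ℕ => (j : ℝ) / (N * ε N) + 1 / N) (by simpa using hlow.add hinv) ?_ ?_
    · filter_upwards with N
      rw [mul_comm, ← div_div]
      gcongr
      exact Nat.le_ceil _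
    · filter_upwards [hε.eventually_const_lt hu, eventually_gt_atTop 0] with N hN hN0
      have hN0' : (0 : ℝ) < N := by exact_mod_cast hN0
      have hpos : 0 < ε N := (pos_iff_pos_of_mul_pos hN).1 hN0'
      rw [mul_comm (N : ℝ) (ε N), ← div_div, ← add_div]
      gcongr
      exact (Nat.ceil_lt_add_one (by positivity)).le
  have hlim : Tendsto (fun N : ℕ => max (2 - j * ((1 : ℝ) / N) -
      max 1 ((⌈(j : ℝ) / ε N⌉₊ : ℝ) / N)) 0) atTop (𝓝 (max (2 - max 1 (j / u)) 0)) := by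
    have := (((tendsto_const_nhds (x := (2 : ℝ))).sub (hinv.const_mul (j : ℝ))).sub
      ((tendsto_const_nhds (x := (1 : ℝ))).max hceil)).max (tendsto_const_nhds (x := (0 : ℝ)))
    simpa using this
  refine hlim.congr' ?_
  filter_upwards [eventually_gt_atTop j] with N hN
  have hN0 : (0 : ℝ) < N := by exact_mod_cast (by omega : 0 < N)
  have hcast : ∀ x y : ℕ, ((x - y : ℕ) : ℝ) = max ((x : ℝ) - y) 0 := fun x y => by
    rcases le_total y x with h | h
    · rw [Nat.cast_sub h, max_eq_left (sub_nonneg.2 (by exact_mod_cast h))]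
    · rw [Nat.sub_eq_zero_of_le h, max_eq_right (sub_nonpos.2 (by exact_mod_cast h)),
        Nat.cast_zero]
  rw [hcast, Nat.cast_sub (by omega), Nat.cast_max, ← max_div_div_right hN0.le, zero_div,
    sub_div, ← max_div_div_right hN0.le, div_self hN0.ne', sub_div]
  push_cast
  rw [mul_div_assoc, div_self hN0.ne']
  ring_nf

lemma sum_range_cast_add_one (n : ℕ) : ∑ j ∈ Finset.range n, ((j : ℝ) + 1) = n * (n + 1) / 2 := by
  induction n with
  | zero => simp
  | succ n ih => rw [Finset.sum_range_succ, ih]; push_cast; ring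

lemma two_mul_sum_eq_ite_even (k : ℕ) {u : ℝ} (hu : 0 < u) (h1 : (k : ℝ) ≤ 2 * u) (h2 : 2 * u < k + 1) :
    2 * ∑ j ∈ Finset.Icc 1 k, max (2 - max 1 ((j : ℝ) / u)) 0 =
      if Even k then 3 * (k : ℝ) - (3 * (k : ℝ) ^ 2 + 2 * k) / (4 * u)
      else 3 * (k : ℝ) + 1 - (3 * (k : ℝ) ^ 2 + 4 * k + 1) / (4 * u) := by
  have hval : ∀ j ∈ Finset.Icc 1 k, max (2 - max 1 ((j : ℝ) / u)) 0 =
      if j ≤ k / 2 then 1 else 2 - (j : ℝ) / u := by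
    intro j hj
    rw [Finset.mem_Icc] at hj
    have hjk : (j : ℝ) ≤ k := by exact_mod_cast hj.2
    split_ifs with h
    · have : (2 * j : ℝ) ≤ k := by exact_mod_cast (by omega : 2 * j ≤ k)
      rw [max_eq_left ((div_le_one hu).2 (by linarith))]
      norm_num
    · have : (k + 1 : ℝ) ≤ 2 * j := by exact_mod_cast (by omega : k + 1 ≤ 2 * j)
      rw [max_eq_right ((one_le_div hu).2 (by linarith)), max_eq_left]
      rw [sub_nonneg, div_le_iff₀ hu]
      linarith
  have hsplit : ∀ m r : ℕ, k = m + r → k / 2 = m →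
      ∑ j ∈ Finset.Icc 1 k, max (2 - max 1 ((j : ℝ) / u)) 0 =
        m + (r * (2 - m / u) - r * (r + 1) / 2 / u) := by
    intro m r hk hm
    rw [Finset.sum_congr rfl hval, hm, hk, ← Finset.Ico_add_one_right_eq_Icc,
      Finset.sum_Ico_eq_sum_range, Nat.add_sub_cancel, Finset.sum_range_add]
    have e1 : ∑ j ∈ Finset.range m, (if 1 + j ≤ m then (1 : ℝ) else 2 - ((1 + j : ℕ) : ℝ) / u) =
        m := by
      rw [Finset.sum_congr rfl (g := fun _ => (1 : ℝ))]
      · simp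
      · intro j hj
        rw [Finset.mem_range] at hj
        rw [if_pos (by omega)]
    have e2 : ∑ j ∈ Finset.range r,
        (if 1 + (m + j) ≤ m then (1 : ℝ) else 2 - ((1 + (m + j) : ℕ) : ℝ) / u) =
        r * (2 - m / u) - r * (r + 1) / 2 / u := by
      rw [← sum_range_cast_add_one, Finset.sum_div, Finset.sum_congr rfl
        (g := fun j : ℕ => (2 - m / u) - ((j : ℝ) + 1) / u)]
      · rw [Finset.sum_sub_distrib]
        simp [mul_sub]
      · intro j _
        rw [if_neg (by omega)]
        push_cast
        ring
    rw [e1, e2]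
  split_ifs with hk
  · obtain ⟨m, rfl⟩ := hk
    rw [hsplit m m rfl (by omega)]
    push_cast
    field_simp
    ring
  · obtain ⟨m, rfl⟩ := Nat.not_even_iff_odd.1 hk
    rw [hsplit m (m + 1) (by omega) (by omega)]
    push_cast
    field_simp
    ring

theorem limit_pair_correlation (s : ℝ) (hs : 0 ≤ s) (k : ℕ)
    (h1 : (k : ℝ) / (2 * Real.log 2) ≤ s) (h2 : s < ((k : ℝ) + 1) / (2 * Real.log 2)) :
    Filter.Tendsto (fun N : ℕ => pcf N s) Filter.atTop
      (nhds (if Even k then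
          3 * (k : ℝ) - (3 * (k : ℝ) ^ 2 + 2 * k) / (4 * Real.log 2 * s)
        else
          3 * (k : ℝ) + 1 - (3 * (k : ℝ) ^ 2 + 4 * k + 1) / (4 * Real.log 2 * s))) := by
  have hlog : 0 < Real.log 2 := Real.log_pos (by norm_num)
  rw [div_le_iff₀ (by positivity)] at h1
  rw [lt_div_iff₀ (by positivity)] at h2
  rcases hs.eq_or_lt with rfl | hs
  · have hk : k = 0 := by
      rw [zero_mul] at h1
      exact_mod_cast le_antisymm h1 (Nat.cast_nonneg k)
    subst hk
    suffices h : Tendsto (fun N : ℕ => pcf N 0) atTop (𝓝 0) by simpa using h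
    refine tendsto_const_nhds.congr fun N => ?_
    have hempty : closePairs N (2 ^ ((0 : ℝ) / N)) ∪ wrapPairs N (2 ^ ((0 : ℝ) / N)) = ∅ := by
      rw [Finset.eq_empty_iff_forall_notMem]
      rintro ⟨a, b⟩ h
      simp only [closePairs, wrapPairs, Finset.mem_union, Finset.mem_filter, Finset.mem_product,
        Finset.mem_Ico, zero_div, Real.rpow_zero, mul_one] at h
      norm_cast at h
      omega
    rw [pcf_eq, hempty]
    simp
  set u := s * Real.log 2 with hu
  have hu0 : 0 < u := by positivity
  have hε := tendsto_mul_two_rpow_sub_one s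
  have hq : ∀ᶠ N : ℕ in atTop,
      1 < (2 : ℝ) ^ (s / N) ∧ 2 * N * ((2 : ℝ) ^ (s / N) - 1) < k + 1 := by
    filter_upwards [eventually_gt_atTop 0,
      hε.eventually_lt_const (show u < (k + 1) / 2 by linarith)] with N hN hlt
    have hN0 : (0 : ℝ) < N := by exact_mod_cast hN
    exact ⟨Real.one_lt_rpow (by norm_num) (by positivity), by linarith⟩
  have hA : Tendsto (fun N : ℕ => 2 * ((closePairs N (2 ^ (s / N))).card : ℝ) / N) atTop
      (𝓝 (2 * ∑ j ∈ Finset.Icc 1 k, max (2 - max 1 ((j : ℝ) / u)) 0)) := by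
    refine ((tendsto_finsetSum (Finset.Icc 1 k)
      fun j _ => tendsto_sub_max_ceil_div hu0 hε j).const_mul 2).congr' ?_
    filter_upwards [hq] with N hN
    rw [card_closePairs hN.1 hN.2, Nat.cast_sum, mul_div_assoc, Finset.sum_div]
  have hB : Tendsto (fun N : ℕ => 2 * ((closePairs N (2 ^ (s / N))).card : ℝ) / N +
      2 * ((k + 1) * (k + 1)) * (1 / (N : ℝ))) atTop
      (𝓝 (2 * ∑ j ∈ Finset.Icc 1 k, max (2 - max 1 ((j : ℝ) / u)) 0)) := by
    simpa using hA.add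
      ((tendsto_one_div_atTop_nhds_zero_nat (𝕜 := ℝ)).const_mul (2 * (((k : ℝ) + 1) * (k + 1))))
  rw [show 4 * Real.log 2 * s = 4 * u by rw [hu]; ring,
    ← two_mul_sum_eq_ite_even k hu0 (by linarith) (by linarith)]
  refine tendsto_of_tendsto_of_tendsto_of_le_of_le' hA hB ?_ ?_
  · filter_upwards with N
    rw [pcf_eq]
    gcongr
    exact Finset.subset_union_left
  · filter_upwards [hq] with N hN
    have hc := (Finset.card_union_le (closePairs N (2 ^ (s / N))) (wrapPairs N (2 ^ (s / N)))).trans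
      (Nat.add_le_add_left (card_wrapPairs_le hN.1.le hN.2) _)
    have hc' : ((closePairs N (2 ^ (s / N)) ∪ wrapPairs N (2 ^ (s / N))).card : ℝ) ≤
        (closePairs N (2 ^ (s / N))).card + (k + 1) * (k + 1) := by exact_mod_cast hc
    rw [pcf_eq, mul_one_div, ← add_div]
    gcongr
    linarith
end

section
/- Fix α with 0 < α < 1. For every s ≥ 0, lim_{N→∞} F_N^α(s) = 3·log(2)·s = 2s·(3/4)·log(4). In particular, since 3·log(2) ≠ 2, the sequence x_n := {log(2n−1)/log 2} does not have weak (α-)pair correlations for any 0 < α < 1. -/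
open scoped Classical

/-- The weak (`α`-)pair correlation function `F_N^α(s)`. -/
noncomputable def pcfWeak (α : ℝ) (N : ℕ) (s : ℝ) : ℝ :=
  (((Finset.Icc 1 N ×ˢ Finset.Icc 1 N).filter
      (fun p => p.1 ≠ p.2 ∧ torusNorm (xseq p.1 - xseq p.2) ≤ s / (N : ℝ) ^ α)).card : ℝ) /
    (N : ℝ) ^ (2 - α)

open Filter Topology Finset

/-- The number of pairs `k, l ≤ N` for which `log₂ (2k - 1) - log₂ (2l - 1)` is within `δ` of `j`. -/
noncomputable def shiftPairCount (δ : ℝ) (N : ℕ) (j : ℤ) : ℕ :=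
  #{p ∈ Icc 1 N ×ˢ Icc 1 N |
    |Real.logb 2 (2 * (p.1 : ℝ) - 1) - Real.logb 2 (2 * (p.2 : ℝ) - 1) - j| ≤ δ}

theorem shiftPairCount_neg (δ : ℝ) (N : ℕ) (j : ℤ) :
    shiftPairCount δ N (-j) = shiftPairCount δ N j := by
  refine card_bij (fun p _ => p.swap) ?_ (fun _ _ _ _ h => Prod.swap_injective h) ?_
  · rintro ⟨k, l⟩ h
    simp only [mem_filter, mem_product, Prod.swap] at h ⊢
    refine ⟨h.1.symm, ?_⟩
    rw [← abs_neg]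
    convert h.2 using 2
    push_cast
    ring
  · rintro ⟨k, l⟩ h
    refine ⟨(l, k), ?_, rfl⟩
    simp only [mem_filter, mem_product] at h ⊢
    refine ⟨h.1.symm, ?_⟩
    rw [← abs_neg]
    convert h.2 using 2
    push_cast
    ring

theorem shiftPairCount_natAbs (δ : ℝ) (N : ℕ) (j : ℤ) :
    shiftPairCount δ N (j.natAbs : ℤ) = shiftPairCount δ N j := by
  rcases Int.natAbs_eq j with h | h
  · rw [← h]
  · conv_rhs => rw [h, shiftPairCount_neg]

theorem abs_logb_sub_logb_sub_le_iff {m n : ℝ} (hm : 0 < m) (hn : 0 < n) (j : ℕ) (δ : ℝ) :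
    |Real.logb 2 m - Real.logb 2 n - j| ≤ δ ↔
      n * 2 ^ j * (2 : ℝ) ^ (-δ) ≤ m ∧ m ≤ n * 2 ^ j * (2 : ℝ) ^ δ := by
  have key (t : ℝ) : Real.logb 2 (n * 2 ^ j * (2 : ℝ) ^ t) = Real.logb 2 n + j + t := by
    rw [Real.logb_mul (by positivity) (by positivity), Real.logb_mul (by positivity) (by positivity),
      Real.logb_rpow (by norm_num) (by norm_num), Real.logb_pow,
      Real.logb_self_eq_one (by norm_num), mul_one]
  rw [← Real.logb_le_logb (b := 2) (by norm_num) (by positivity) hm,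
    ← Real.logb_le_logb (b := 2) (by norm_num) hm (by positivity), key, key, abs_le]
  constructor <;> rintro ⟨h, h'⟩ <;> constructor <;> linarith

theorem two_mul_cast_sub_one_pos {l : ℕ} (hl : 1 ≤ l) : (0 : ℝ) < 2 * (l : ℝ) - 1 := by
  have : (1 : ℝ) ≤ l := by exact_mod_cast hl
  linarith

theorem card_odd_between_le (N : ℕ) {a b : ℝ} (ha : 0 ≤ a) (hab : a ≤ b) :
    (#{k ∈ Icc 1 N | a ≤ 2 * ((k : ℕ) : ℝ) - 1 ∧ 2 * ((k : ℕ) : ℝ) - 1 ≤ b} : ℝ) ≤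
      (b - a) / 2 + 1 := by
  have hsub : {k ∈ Icc 1 N | a ≤ 2 * ((k : ℕ) : ℝ) - 1 ∧ 2 * ((k : ℕ) : ℝ) - 1 ≤ b} ⊆
      Icc ⌈(a + 1) / 2⌉₊ ⌊(b + 1) / 2⌋₊ := by
    intro k hk
    simp only [mem_filter, mem_Icc] at hk ⊢
    exact ⟨Nat.ceil_le.2 (by linarith), Nat.le_floor (by linarith)⟩
  have hcard := card_le_card hsub
  rw [Nat.card_Icc] at hcard
  refine (Nat.cast_le.2 hcard).trans ?_
  have h₁ := Nat.le_ceil ((a + 1) / 2)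
  have h₂ := Nat.floor_le (show 0 ≤ (b + 1) / 2 by linarith)
  rcases le_total ⌈(a + 1) / 2⌉₊ (⌊(b + 1) / 2⌋₊ + 1) with h | h
  · rw [Nat.cast_sub h]
    push_cast
    linarith
  · rw [Nat.sub_eq_zero_of_le h]
    push_cast
    linarith

theorem le_card_odd_between (N : ℕ) {a b : ℝ} (ha : 0 ≤ a) (hb : b ≤ 2 * N - 1) :
    (b - a) / 2 - 1 ≤
      (#{k ∈ Icc 1 N | a ≤ 2 * ((k : ℕ) : ℝ) - 1 ∧ 2 * ((k : ℕ) : ℝ) - 1 ≤ b} : ℝ) := by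
  rcases lt_or_ge b 0 with hb0 | hb0
  · refine le_trans ?_ (Nat.cast_nonneg _)
    linarith
  have hsub : Icc ⌈(a + 1) / 2⌉₊ ⌊(b + 1) / 2⌋₊ ⊆
      {k ∈ Icc 1 N | a ≤ 2 * ((k : ℕ) : ℝ) - 1 ∧ 2 * ((k : ℕ) : ℝ) - 1 ≤ b} := by
    intro k hk
    simp only [mem_filter, mem_Icc] at hk ⊢
    have h₁ := Nat.ceil_le.1 hk.1
    have h₂ := (Nat.le_floor_iff (by linarith)).1 hk.2
    refine ⟨⟨?_, ?_⟩, by linarith, by linarith⟩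
    · have : (0 : ℝ) < k := by linarith
      exact_mod_cast this
    · have : (k : ℝ) ≤ N := by linarith
      exact_mod_cast this
  have hcard := card_le_card hsub
  rw [Nat.card_Icc] at hcard
  refine le_trans ?_ (Nat.cast_le.2 hcard)
  have h₁ := Nat.ceil_lt_add_one (show 0 ≤ (a + 1) / 2 by linarith)
  have h₂ := Nat.lt_floor_add_one ((b + 1) / 2)
  have h₃ : ((⌊(b + 1) / 2⌋₊ + 1 : ℕ) : ℝ) ≤
      ((⌊(b + 1) / 2⌋₊ + 1 - ⌈(a + 1) / 2⌉₊ : ℕ) : ℝ) + (⌈(a + 1) / 2⌉₊ : ℝ) := by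
    exact_mod_cast le_tsub_add
  push_cast at h₃
  linarith

theorem sum_Icc_odd (X : ℕ) : ∑ l ∈ Icc 1 X, (2 * (l : ℝ) - 1) = (X : ℝ) ^ 2 := by
  induction X with
  | zero => simp
  | succ n ih =>
    rw [sum_Icc_succ_top (by omega), ih]
    push_cast
    ring

theorem shiftPairCount_eq_sum (δ : ℝ) (N j : ℕ) :
    shiftPairCount δ N j = ∑ l ∈ Icc 1 N, #{k ∈ Icc 1 N |
      (2 * (l : ℝ) - 1) * 2 ^ j * (2 : ℝ) ^ (-δ) ≤ 2 * ((k : ℕ) : ℝ) - 1 ∧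
        2 * ((k : ℕ) : ℝ) - 1 ≤ (2 * (l : ℝ) - 1) * 2 ^ j * (2 : ℝ) ^ δ} := by
  rw [shiftPairCount, card_filter, sum_product_right]
  refine sum_congr rfl fun l hl => ?_
  rw [card_filter]
  refine sum_congr rfl fun k hk => ?_
  have := abs_logb_sub_logb_sub_le_iff (two_mul_cast_sub_one_pos (mem_Icc.1 hk).1)
    (two_mul_cast_sub_one_pos (mem_Icc.1 hl).1) j δ
  simp only [Int.cast_natCast, this]

theorem sum_Icc_odd_mul_add (X : ℕ) (c d : ℝ) :
    ∑ l ∈ Icc 1 X, ((2 * (l : ℝ) - 1) * c + d) = (X : ℝ) ^ 2 * c + X * d := by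
  rw [sum_add_distrib, ← sum_mul, sum_Icc_odd, sum_const, Nat.card_Icc, nsmul_eq_mul,
    Nat.add_sub_cancel]

theorem shiftPairCount_le {δ : ℝ} (hδ : 0 ≤ δ) (N j X : ℕ)
    (hX : ∀ l : ℕ, (2 * (l : ℝ) - 1) * 2 ^ j * (2 : ℝ) ^ (-δ) ≤ 2 * N - 1 → l ≤ X) :
    (shiftPairCount δ N j : ℝ) ≤
      (X : ℝ) ^ 2 * (2 ^ j * ((2 : ℝ) ^ δ - 2 ^ (-δ)) / 2) + X := by
  have hr : (2 : ℝ) ^ (-δ) ≤ 2 ^ δ := Real.rpow_le_rpow_of_exponent_le (by norm_num) (by linarith)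
  rw [shiftPairCount_eq_sum, Nat.cast_sum]
  have hsum := sum_Icc_odd_mul_add X (2 ^ j * ((2 : ℝ) ^ δ - 2 ^ (-δ)) / 2) 1
  rw [mul_one] at hsum
  rw [← hsum]
  have hvanish : ∀ l ∈ Icc 1 N, #{k ∈ Icc 1 N |
      (2 * (l : ℝ) - 1) * 2 ^ j * (2 : ℝ) ^ (-δ) ≤ 2 * ((k : ℕ) : ℝ) - 1 ∧
        2 * ((k : ℕ) : ℝ) - 1 ≤ (2 * (l : ℝ) - 1) * 2 ^ j * (2 : ℝ) ^ δ} ≠ 0 → l ≤ X := by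
    intro l _ hl
    obtain ⟨k, hk⟩ := card_ne_zero.1 hl
    simp only [mem_filter, mem_Icc] at hk
    have hkN : (k : ℝ) ≤ N := by exact_mod_cast hk.1.2
    exact hX l (hk.2.1.trans (by linarith))
  rw [← sum_filter_of_ne (p := fun l => l ≤ X)
    fun l hl h => hvanish l hl fun h' => h (by rw [h', Nat.cast_zero])]
  refine (sum_le_sum fun l hl => ?_).trans
    (sum_le_sum_of_subset_of_nonneg (s := {l ∈ Icc 1 N | l ≤ X}) ?_ fun l hl _ => ?_)
  · have hl0 := two_mul_cast_sub_one_pos (mem_Icc.1 (mem_filter.1 hl).1).1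
    refine (card_odd_between_le N (by positivity) (by gcongr)).trans (le_of_eq ?_)
    ring
  · intro l hl
    simp only [mem_filter, mem_Icc] at hl ⊢
    exact ⟨hl.1.1, hl.2⟩
  · have hl0 := two_mul_cast_sub_one_pos (mem_Icc.1 hl).1
    have := sub_nonneg.2 hr
    positivity

theorem le_shiftPairCount (δ : ℝ) (N j Y : ℕ) (hYN : Y ≤ N)
    (hY : (2 * (Y : ℝ) - 1) * 2 ^ j * (2 : ℝ) ^ δ ≤ 2 * N - 1) :
    (Y : ℝ) ^ 2 * (2 ^ j * ((2 : ℝ) ^ δ - 2 ^ (-δ)) / 2) - Y ≤ (shiftPairCount δ N j : ℝ) := by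
  rw [shiftPairCount_eq_sum, Nat.cast_sum]
  have hsum := sum_Icc_odd_mul_add Y (2 ^ j * ((2 : ℝ) ^ δ - 2 ^ (-δ)) / 2) (-1)
  rw [mul_neg_one, ← sub_eq_add_neg] at hsum
  rw [← hsum]
  refine le_trans (sum_le_sum fun l hl => ?_)
    (sum_le_sum_of_subset_of_nonneg (Icc_subset_Icc_right hYN) fun _ _ _ => Nat.cast_nonneg _)
  obtain ⟨hl₁, hlY⟩ := mem_Icc.1 hl
  have hl0 := two_mul_cast_sub_one_pos hl₁
  have hlY' : (l : ℝ) ≤ Y := by exact_mod_cast hlY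
  refine le_trans (le_of_eq ?_) (le_card_odd_between N (by positivity) (le_trans ?_ hY))
  · ring
  · gcongr

/-- The window width `2 ^ δ - 2 ^ (-δ)` with `δ = s / N ^ α` is asymptotic to `2 s log 2 / N ^ α`. -/
theorem tendsto_window_mul_rpow {α : ℝ} (h0 : 0 < α) (s : ℝ) :
    Tendsto (fun N : ℕ => ((2 : ℝ) ^ (s / (N : ℝ) ^ α) - 2 ^ (-(s / (N : ℝ) ^ α))) * (N : ℝ) ^ α)
      atTop (𝓝 (2 * s * Real.log 2)) := by
  have hd : HasDerivAt (fun t : ℝ => (2 : ℝ) ^ (s * t) - 2 ^ (-(s * t))) (2 * s * Real.log 2) 0 := by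
    have h₁ : HasDerivAt (fun t : ℝ => s * t) s 0 := by
      simpa using (hasDerivAt_id (0 : ℝ)).const_mul s
    have h₂ := (h₁.const_rpow (a := 2) (by norm_num)).sub (h₁.neg.const_rpow (a := 2) (by norm_num))
    refine h₂.congr_deriv ?_
    simp only [Pi.neg_apply, mul_zero, neg_zero, Real.rpow_zero]
    ring
  have ht : Tendsto (fun N : ℕ => ((N : ℝ) ^ α)⁻¹) atTop (𝓝[≠] 0) := by
    rw [tendsto_nhdsWithin_iff]
    refine ⟨((tendsto_rpow_atTop h0).comp tendsto_natCast_atTop_atTop).inv_tendsto_atTop, ?_⟩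
    filter_upwards [eventually_gt_atTop 0] with N hN
    have : (0 : ℝ) < N := by exact_mod_cast hN
    exact inv_ne_zero (by positivity)
  refine (hd.tendsto_slope.comp ht).congr fun N => ?_
  simp [slope, div_eq_mul_inv, mul_comm]

theorem tendsto_div_rpow_zero {α : ℝ} (h0 : 0 < α) (s : ℝ) :
    Tendsto (fun N : ℕ => s / (N : ℝ) ^ α) atTop (𝓝 0) :=
  ((tendsto_rpow_atTop h0).comp tendsto_natCast_atTop_atTop).const_div_atTop s

theorem tendsto_rpow_sub_one_zero {α : ℝ} (h1 : α < 1) :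
    Tendsto (fun N : ℕ => (N : ℝ) ^ (α - 1)) atTop (𝓝 0) := by
  have := (tendsto_rpow_neg_atTop (show 0 < 1 - α by linarith)).comp tendsto_natCast_atTop_atTop
  simpa [Function.comp_def] using this

theorem tendsto_two_rpow_one {α : ℝ} (h0 : 0 < α) (s : ℝ) :
    Tendsto (fun N : ℕ => (2 : ℝ) ^ (s / (N : ℝ) ^ α)) atTop (𝓝 1) := by
  simpa using (tendsto_const_nhds (x := (2 : ℝ))).rpow (tendsto_div_rpow_zero h0 s)
    (Or.inl two_ne_zero)

theorem normalize_main_term (α : ℝ) {N : ℕ} (hN : 0 < N) (X B w e : ℝ) :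
    (X ^ 2 * (B * w / 2) + X * e) / (N : ℝ) ^ (2 - α) =
      (X / N) ^ 2 * (B * (w * (N : ℝ) ^ α) / 2) + X / N * (N : ℝ) ^ (α - 1) * e := by
  have hN' : (0 : ℝ) < N := by exact_mod_cast hN
  have h₁ : (N : ℝ) ^ (2 - α) = (N : ℝ) ^ 2 / (N : ℝ) ^ α := by
    rw [Real.rpow_sub hN']; norm_cast
  rw [h₁, Real.rpow_sub hN', Real.rpow_one]
  field_simp

theorem tendsto_div_natCast_of_abs_sub_le {X c : ℕ → ℝ} {C L : ℝ} (hc : Tendsto c atTop (𝓝 L))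
    (hX : ∀ᶠ N : ℕ in atTop, |X N - N * c N| ≤ C) :
    Tendsto (fun N : ℕ => X N / N) atTop (𝓝 L) := by
  have h₁ : Tendsto (fun N : ℕ => X N / N - c N) atTop (𝓝 0) := by
    refine squeeze_zero_norm' ?_ (tendsto_const_div_atTop_nhds_zero_nat C)
    filter_upwards [hX, eventually_gt_atTop 0] with N hN h
    have h' : (0 : ℝ) < N := by exact_mod_cast h
    rw [Real.norm_eq_abs, show X N / N - c N = (X N - N * c N) / N by field_simp, abs_div,
      abs_of_pos h']
    gcongr
  simpa using h₁.add hc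

theorem le_mul_of_mul_rpow_neg_le {n B δ M : ℝ} (hB : 0 < B) (h : n * B * (2 : ℝ) ^ (-δ) ≤ M) :
    n ≤ M * ((2 : ℝ) ^ δ / B) := by
  rw [Real.rpow_neg (by norm_num), ← div_eq_mul_inv, div_le_iff₀ (by positivity)] at h
  rw [← mul_div_assoc, le_div_iff₀ hB]
  exact h

theorem tendsto_shiftPairCount_div {α s : ℝ} (h0 : 0 < α) (h1 : α < 1) (hs : 0 ≤ s) (j : ℕ) :
    Tendsto (fun N : ℕ => (shiftPairCount (s / (N : ℝ) ^ α) N j : ℝ) / (N : ℝ) ^ (2 - α)) atTop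
      (𝓝 (s * Real.log 2 * (1 / 2) ^ j)) := by
  have hB : (1 : ℝ) ≤ 2 ^ j := one_le_pow₀ (by norm_num)
  have hr (N : ℕ) : (1 : ℝ) ≤ (2 : ℝ) ^ (s / (N : ℝ) ^ α) :=
    Real.one_le_rpow (by norm_num) (by positivity)
  have hlim {X : ℕ → ℝ} (e : ℝ) (hX : Tendsto (fun N : ℕ => X N / N) atTop (𝓝 (1 / 2 ^ j))) :
      Tendsto (fun N : ℕ => (X N ^ 2 * (2 ^ j *
        ((2 : ℝ) ^ (s / (N : ℝ) ^ α) - 2 ^ (-(s / (N : ℝ) ^ α))) / 2) + X N * e) /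
          (N : ℝ) ^ (2 - α)) atTop (𝓝 (s * Real.log 2 * (1 / 2) ^ j)) := by
    have h := ((hX.pow 2).mul (((tendsto_window_mul_rpow h0 s).const_mul (2 ^ j)).div_const 2)).add
      ((hX.mul (tendsto_rpow_sub_one_zero h1)).mul_const e)
    have hval : (1 / 2 ^ j : ℝ) ^ 2 * (2 ^ j * (2 * s * Real.log 2) / 2) + 1 / 2 ^ j * 0 * e =
        s * Real.log 2 * (1 / 2) ^ j := by
      rw [one_div_pow (2 : ℝ) j]
      field_simp
      ring
    rw [hval] at h
    refine h.congr' ?_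
    filter_upwards [eventually_gt_atTop 0] with N hN
    rw [normalize_main_term α hN]
  have hlower : Tendsto (fun N : ℕ =>
      ((⌊(N : ℝ) * (1 / (2 ^ j * (2 : ℝ) ^ (s / (N : ℝ) ^ α)))⌋₊ : ℕ) : ℝ) / N) atTop
      (𝓝 (1 / 2 ^ j)) := by
    refine tendsto_div_natCast_of_abs_sub_le (C := 1)
      (c := fun N : ℕ => 1 / (2 ^ j * (2 : ℝ) ^ (s / (N : ℝ) ^ α))) ?_ (Eventually.of_forall ?_)
    · simpa using (((tendsto_two_rpow_one h0 s).const_mul (2 ^ j)).inv₀ (by positivity))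
    · intro N
      have h₁ := Nat.floor_le (show 0 ≤ (N : ℝ) * (1 / (2 ^ j * (2 : ℝ) ^ (s / (N : ℝ) ^ α))) by
        positivity)
      have h₂ := Nat.lt_floor_add_one ((N : ℝ) * (1 / (2 ^ j * (2 : ℝ) ^ (s / (N : ℝ) ^ α))))
      rw [abs_le]
      constructor <;> linarith
  have hupper : Tendsto (fun N : ℕ =>
      ((⌊(N : ℝ) * ((2 : ℝ) ^ (s / (N : ℝ) ^ α) / 2 ^ j) + 1⌋₊ : ℕ) : ℝ) / N) atTop
      (𝓝 (1 / 2 ^ j)) := by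
    refine tendsto_div_natCast_of_abs_sub_le (C := 1)
      (c := fun N : ℕ => (2 : ℝ) ^ (s / (N : ℝ) ^ α) / 2 ^ j)
      ((tendsto_two_rpow_one h0 s).div_const _) (Eventually.of_forall ?_)
    intro N
    have h₁ := Nat.floor_le (show 0 ≤ (N : ℝ) * ((2 : ℝ) ^ (s / (N : ℝ) ^ α) / 2 ^ j) + 1 by
      positivity)
    have h₂ := Nat.lt_floor_add_one ((N : ℝ) * ((2 : ℝ) ^ (s / (N : ℝ) ^ α) / 2 ^ j) + 1)
    rw [abs_le]
    constructor <;> linarith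
  refine tendsto_of_tendsto_of_tendsto_of_le_of_le (hlim (-1) hlower) (hlim 1 hupper)
    (fun N => ?_) (fun N => ?_)
  · dsimp only
    gcongr
    rw [mul_neg_one, ← sub_eq_add_neg]
    have hBr : (1 : ℝ) ≤ 2 ^ j * (2 : ℝ) ^ (s / (N : ℝ) ^ α) :=
      one_le_mul_of_one_le_of_one_le hB (hr N)
    have hY := Nat.floor_le (show 0 ≤ (N : ℝ) * (1 / (2 ^ j * (2 : ℝ) ^ (s / (N : ℝ) ^ α))) by
      positivity)
    rw [mul_one_div] at hY ⊢
    have hY' := (le_div_iff₀ (by positivity)).1 hY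
    refine le_shiftPairCount _ N j _ ?_ ?_
    · have : (⌊(N : ℝ) / (2 ^ j * (2 : ℝ) ^ (s / (N : ℝ) ^ α))⌋₊ : ℝ) ≤ N :=
        hY.trans (div_le_self (by positivity) hBr)
      exact_mod_cast this
    · rw [mul_assoc, sub_mul, mul_assoc]
      linarith
  · dsimp only
    gcongr
    rw [mul_one]
    refine shiftPairCount_le (by positivity) N j _ fun l hl => Nat.le_floor ?_
    have hl' := le_mul_of_mul_rpow_neg_le (by positivity) hl
    have hc : 0 ≤ (2 : ℝ) ^ (s / (N : ℝ) ^ α) / 2 ^ j := by positivity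
    linarith

theorem exists_bound_shiftPairCount_div {α s : ℝ} (h0 : 0 < α) (h1 : α < 1) (hs : 0 ≤ s) :
    ∃ C : ℝ, ∀ᶠ N : ℕ in atTop, ∀ j : ℕ,
      (shiftPairCount (s / (N : ℝ) ^ α) N j : ℝ) / (N : ℝ) ^ (2 - α) ≤ C * (1 / 2) ^ j := by
  refine ⟨8 * (2 * s * Real.log 2 + 1) + 4, ?_⟩
  filter_upwards [(tendsto_window_mul_rpow h0 s).eventually_le_const (lt_add_one _),
    (tendsto_rpow_sub_one_zero h1).eventually_le_const zero_lt_one,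
    (tendsto_two_rpow_one h0 s).eventually_le_const one_lt_two, eventually_gt_atTop 0]
    with N hw hN₁ hr hN j
  have hN' : (0 : ℝ) < N := by exact_mod_cast hN
  set δ := s / (N : ℝ) ^ α
  have hδ0 : 0 ≤ δ := by positivity
  have hw0 : 0 ≤ (2 : ℝ) ^ δ - 2 ^ (-δ) := sub_nonneg.2
    (Real.rpow_le_rpow_of_exponent_le (by norm_num) (by linarith))
  have hX : ((⌊2 * (N : ℝ) * ((2 : ℝ) ^ δ / 2 ^ j)⌋₊ : ℕ) : ℝ) / N ≤ 4 / 2 ^ j := by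
    rw [div_le_iff₀ hN']
    refine (Nat.floor_le (by positivity)).trans ?_
    have : (2 : ℝ) ^ δ / 2 ^ j ≤ 2 / 2 ^ j := by gcongr
    calc 2 * (N : ℝ) * ((2 : ℝ) ^ δ / 2 ^ j) ≤ 2 * (N : ℝ) * (2 / 2 ^ j) := by gcongr
      _ = 4 / 2 ^ j * N := by ring
  have hcount := shiftPairCount_le hδ0 N j ⌊2 * (N : ℝ) * ((2 : ℝ) ^ δ / 2 ^ j)⌋₊ fun l hl => by
    rcases Nat.eq_zero_or_pos l with rfl | hl0
    · exact Nat.zero_le _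
    refine Nat.le_floor ?_
    have hl₁ : (1 : ℝ) ≤ l := by exact_mod_cast hl0
    have hl' := le_mul_of_mul_rpow_neg_le (by positivity) hl
    have hc : 0 ≤ (2 : ℝ) ^ δ / 2 ^ j := by positivity
    linarith
  set X := ⌊2 * (N : ℝ) * ((2 : ℝ) ^ δ / 2 ^ j)⌋₊
  calc (shiftPairCount δ N j : ℝ) / (N : ℝ) ^ (2 - α)
      ≤ ((X : ℝ) ^ 2 * (2 ^ j * ((2 : ℝ) ^ δ - 2 ^ (-δ)) / 2) + X * 1) / (N : ℝ) ^ (2 - α) := by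
        rw [mul_one]
        gcongr
    _ = (X / N : ℝ) ^ 2 * (2 ^ j * (((2 : ℝ) ^ δ - 2 ^ (-δ)) * (N : ℝ) ^ α) / 2) +
        X / N * (N : ℝ) ^ (α - 1) * 1 := normalize_main_term α hN _ _ _ _
    _ ≤ (4 / 2 ^ j) ^ 2 * (2 ^ j * (2 * s * Real.log 2 + 1) / 2) + 4 / 2 ^ j * 1 * 1 := by
      gcongr
    _ = _ := by
      rw [one_div_pow (2 : ℝ) j]
      field_simp
      ring

theorem torusNorm_xseq_sub (k l : ℕ) :
    torusNorm (xseq k - xseq l) =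
      torusNorm (Real.logb 2 (2 * (k : ℝ) - 1) - Real.logb 2 (2 * (l : ℝ) - 1)) := by
  have h : xseq k - xseq l = Real.logb 2 (2 * (k : ℝ) - 1) - Real.logb 2 (2 * (l : ℝ) - 1) -
      ((⌊Real.logb 2 (2 * (k : ℝ) - 1)⌋ - ⌊Real.logb 2 (2 * (l : ℝ) - 1)⌋ : ℤ) : ℝ) := by
    simp only [xseq, Real.log_div_log, Int.fract]
    push_cast
    ring
  rw [h, torusNorm, torusNorm, round_sub_intCast]
  push_cast
  congr 1
  ring

theorem round_eq_and_torusNorm_le_iff {δ : ℝ} (hδ : δ < 1 / 2) (t : ℝ) (j : ℤ) :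
    torusNorm t ≤ δ ∧ round t = j ↔ |t - j| ≤ δ := by
  constructor
  · rintro ⟨h, rfl⟩
    exact h
  · intro h
    have hj : round t = j := by
      rw [round_eq, Int.floor_eq_iff]
      rw [abs_le] at h
      constructor <;> linarith
    exact ⟨by rwa [torusNorm, hj], hj⟩

theorem card_torusNorm_le_eq_tsum {δ : ℝ} (hδ : δ < 1 / 2) (N : ℕ) :
    (#{p ∈ Icc 1 N ×ˢ Icc 1 N | torusNorm (xseq p.1 - xseq p.2) ≤ δ} : ℝ) =
      ∑' j : ℤ, (shiftPairCount δ N j : ℝ) := by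
  set S := {p ∈ Icc 1 N ×ˢ Icc 1 N | torusNorm (xseq p.1 - xseq p.2) ≤ δ} with hS
  set g : ℕ × ℕ → ℤ := fun p =>
    round (Real.logb 2 (2 * (p.1 : ℝ) - 1) - Real.logb 2 (2 * (p.2 : ℝ) - 1)) with hg
  have hfiber (j : ℤ) : shiftPairCount δ N j = #{p ∈ S | g p = j} := by
    rw [hS, filter_filter, shiftPairCount]
    simp only [hg, torusNorm_xseq_sub, round_eq_and_torusNorm_le_iff hδ]
  rw [tsum_eq_sum (s := S.image g), card_eq_sum_card_image g S]
  · push_cast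
    simp only [hfiber]
  · intro j hj
    rw [hfiber, Nat.cast_eq_zero, card_eq_zero, filter_eq_empty_iff]
    rintro p hp rfl
    exact hj (mem_image_of_mem g hp)

theorem card_torusNorm_le_eq_add {δ : ℝ} (hδ : 0 ≤ δ) (N : ℕ) :
    #{p ∈ Icc 1 N ×ˢ Icc 1 N | torusNorm (xseq p.1 - xseq p.2) ≤ δ} =
      #{p ∈ Icc 1 N ×ˢ Icc 1 N | p.1 ≠ p.2 ∧ torusNorm (xseq p.1 - xseq p.2) ≤ δ} + N := by
  have hdiag : {p ∈ Icc 1 N ×ˢ Icc 1 N | p.1 = p.2 ∧ torusNorm (xseq p.1 - xseq p.2) ≤ δ} =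
      (Icc 1 N).diag := by
    ext ⟨k, l⟩
    simp only [mem_filter, mem_product, mem_diag]
    constructor
    · rintro ⟨⟨hk, _⟩, rfl, _⟩
      exact ⟨hk, rfl⟩
    · rintro ⟨hk, rfl⟩
      exact ⟨⟨hk, hk⟩, rfl, by simpa [torusNorm] using hδ⟩
  have hcard : #(Icc 1 N).diag = N := by simp
  rw [← hdiag] at hcard
  rw [← card_filter_add_card_filter_not (fun p : ℕ × ℕ => p.1 ≠ p.2), filter_filter, filter_filter]
  simp only [not_not, and_comm (b := _ ≠ _), and_comm (b := _ = _), hcard]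

theorem hasSum_half_pow_natAbs : HasSum (fun j : ℤ => (1 / 2 : ℝ) ^ j.natAbs) 3 := by
  have h₁ := hasSum_geometric_two
  have h₂ : HasSum (fun n : ℕ => (1 / 2 : ℝ) ^ (n + 1)) 1 := by
    have := h₁.mul_right (1 / 2)
    simpa [pow_succ] using this
  have h := HasSum.of_nat_of_neg_add_one (f := fun j : ℤ => (1 / 2 : ℝ) ^ j.natAbs)
    (m := 2) (m' := 1) (by simpa using h₁) ?_
  · norm_num at h ⊢
    exact h
  · convert h₂ using 3 with n
    omega

theorem tendsto_pcfWeak {α s : ℝ} (h0 : 0 < α) (h1 : α < 1) (hs : 0 ≤ s) :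
    Tendsto (fun N : ℕ => pcfWeak α N s) atTop (𝓝 (3 * Real.log 2 * s)) := by
  obtain ⟨C, hC⟩ := exists_bound_shiftPairCount_div h0 h1 hs
  have hmain : Tendsto (fun N : ℕ => ∑' j : ℤ,
      (shiftPairCount (s / (N : ℝ) ^ α) N j : ℝ) / (N : ℝ) ^ (2 - α)) atTop
      (𝓝 (∑' j : ℤ, s * Real.log 2 * (1 / 2) ^ j.natAbs)) := by
    refine tendsto_tsum_of_dominated_convergence (bound := fun j : ℤ => C * (1 / 2) ^ j.natAbs)
      (hasSum_half_pow_natAbs.summable.mul_left C) (fun j => ?_) ?_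
    · simp only [← shiftPairCount_natAbs _ _ j]
      exact tendsto_shiftPairCount_div h0 h1 hs j.natAbs
    · filter_upwards [hC] with N hN j
      rw [← shiftPairCount_natAbs, Real.norm_of_nonneg (by positivity)]
      exact hN j.natAbs
  rw [(hasSum_half_pow_natAbs.mul_left (s * Real.log 2)).tsum_eq] at hmain
  have h := hmain.sub (tendsto_rpow_sub_one_zero h1)
  rw [sub_zero, show s * Real.log 2 * 3 = 3 * Real.log 2 * s by ring] at h
  refine h.congr' ?_
  filter_upwards [(tendsto_div_rpow_zero h0 s).eventually_lt_const (show (0 : ℝ) < 1 / 2 by norm_num),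
    eventually_gt_atTop 0] with N hδ hN
  have hN' : (0 : ℝ) < N := by exact_mod_cast hN
  have hpow : (N : ℝ) ^ (α - 1) = N / (N : ℝ) ^ (2 - α) := by
    rw [show α - 1 = 1 - (2 - α) by ring, Real.rpow_sub hN', Real.rpow_one]
  rw [tsum_div_const, ← card_torusNorm_le_eq_tsum hδ, hpow, ← sub_div,
    card_torusNorm_le_eq_add (by positivity), pcfWeak, Nat.cast_add, add_sub_cancel_right]

theorem weak_pair_correlation (α : ℝ) (h0 : 0 < α) (h1 : α < 1) :
    (∀ s : ℝ, 0 ≤ s →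
      Filter.Tendsto (fun N : ℕ => pcfWeak α N s) Filter.atTop
        (nhds (3 * Real.log 2 * s))) ∧
    ¬ (∀ s : ℝ, 0 ≤ s →
      Filter.Tendsto (fun N : ℕ => pcfWeak α N s) Filter.atTop (nhds (2 * s))) := by
  refine ⟨fun s hs => tendsto_pcfWeak h0 h1 hs, fun h => ?_⟩
  have := tendsto_nhds_unique (h 1 zero_le_one) (tendsto_pcfWeak h0 h1 zero_le_one)
  linarith [Real.log_two_gt_d9]
end
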